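/- arXiv:2008.13440 — 3 statements merged into one kernel-verified Lean document; each statement's English description precedes it below -/
import Mathlib

section
/- Let N be a positive natural number, let Q be an invertible N×N real matrix, let r¹ : Fin N → ℝ, let m₁ ∈ {−1, 1}, let c : Fin N → ℝ, define z_A = ∑_a r_a¹ (Q⁻¹)_{aA} and k_a = m₁ · ∑_{A,b} (Q⁻¹)_{aA} · c_A² · r_b¹ · (Q⁻¹)_{bA}. Then ∑_a r_a¹ k_a = m₁ · ∑_A c_A² · z_A². Moreover, if there exists a flavor A with c_A ≠ 0 and z_A ≠ 0, then ∑_a r_a¹ k_a ≠ 0. -/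
open Matrix BigOperators

/-- Theorem 3 of the paper: for type A solutions
`∑_a r_a¹ k^a = m₁ ∑_A c_A² z_A²`, which is nonzero for nontrivial
solutions. -/
theorem stmt_13 (N : ℕ) (hN : 0 < N) (Q : Matrix (Fin N) (Fin N) ℝ)
    (hQ : IsUnit Q.det) (r1 : Fin N → ℝ) (m₁ : ℝ) (hm : m₁ = 1 ∨ m₁ = -1)
    (c : Fin N → ℝ) (z : Fin N → ℝ)
    (hz : ∀ A, z A = ∑ a, r1 a * Q⁻¹ a A)
    (k : Fin N → ℝ)
    (hk : ∀ a, k a = m₁ * ∑ A, ∑ b, Q⁻¹ a A * c A ^ 2 * r1 b * Q⁻¹ b A) :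
    (∑ a, r1 a * k a = m₁ * ∑ A, c A ^ 2 * z A ^ 2) ∧
      ((∃ A, c A ≠ 0 ∧ z A ≠ 0) → (∑ a, r1 a * k a) ≠ 0) := by
  have key : ∑ a, r1 a * k a = m₁ * ∑ A, c A ^ 2 * z A ^ 2 := by
    have h1 : ∀ a, r1 a * k a = ∑ A, m₁ * (c A ^ 2 * ((r1 a * Q⁻¹ a A) * z A)) := by
      intro a
      rw [hk a, Finset.mul_sum, Finset.mul_sum]
      refine Finset.sum_congr rfl fun A _ => ?_
      rw [hz A]
      simp only [Finset.mul_sum]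
      refine Finset.sum_congr rfl fun b _ => ?_
      ring
    rw [Finset.sum_congr rfl fun a _ => h1 a, Finset.sum_comm, Finset.mul_sum]
    refine Finset.sum_congr rfl fun A _ => ?_
    rw [← Finset.mul_sum, ← Finset.mul_sum, ← Finset.sum_mul, ← hz A]
    ring
  refine ⟨key, ?_⟩
  rintro ⟨A, hc, hzA⟩
  rw [key]
  have hm0 : m₁ ≠ 0 := by rcases hm with h | h <;> rw [h] <;> norm_num
  have hpos : 0 < ∑ A, c A ^ 2 * z A ^ 2 :=
    Finset.sum_pos' (fun B _ => by positivity) ⟨A, Finset.mem_univ A, by positivity⟩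
  exact mul_ne_zero hm0 hpos.ne'
end

section
/- Let Ñ and N̂ be positive natural numbers, let Q̃ be an invertible Ñ×Ñ real matrix and Q̂ an invertible N̂×N̂ real matrix, and let Q be the (Ñ+N̂)×(Ñ+N̂) block-diagonal matrix Q = diag(Q̃, Q̂) (so Q⁻¹ = diag(Q̃⁻¹, Q̂⁻¹)). Let n : Fin (Ñ+N̂) → ℝ be supported on the first block (n_Â = 0 for the last N̂ indices Â) and define k_a = ∑_A (Q⁻¹)_{aA} n_A. Let m ∈ ℝ³ and let r : Fin (Ñ+N̂) → ℝ³ satisfy r_ã = ρ_ã · m for every index ã in the first block, for some scalars ρ_ã ∈ ℝ. Then: (i) k_â = 0 for every index â in the second block; (ii) for every first-block flavor index Ã, ∑_a r_a (Q⁻¹)_{aÃ} = (∑_ã ρ_ã (Q̃⁻¹)_{ãÃ}) · m; and (iii) ∑_a r_a k_a = (∑_{ã,Ã} ρ_ã (Q̃⁻¹)_{ãÃ} n_Ã) · m. In particular both ∑_a r_a (Q⁻¹)_{aÃ} and ∑_a r_a k_a are parallel to m. -/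
open Matrix BigOperators

/-- The block-diagonal (type B2) part of Theorem 4: with `Q = diag(Q̃, Q̂)`
and winding numbers supported on the first block, the fluxes vanish on the
second block, and both `∑_a r_a (Q⁻¹)_{aÃ}` and `∑_a r_a k^a` are parallel
to `m` whenever the first-block FI vectors are. -/
theorem stmt_14 (Nt Nh : ℕ) (hNt : 0 < Nt) (hNh : 0 < Nh)
    (Qt : Matrix (Fin Nt) (Fin Nt) ℝ) (Qh : Matrix (Fin Nh) (Fin Nh) ℝ)
    (hQt : IsUnit Qt.det) (hQh : IsUnit Qh.det)
    (Q : Matrix (Fin Nt ⊕ Fin Nh) (Fin Nt ⊕ Fin Nh) ℝ)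
    (hQ : Q = Matrix.fromBlocks Qt 0 0 Qh)
    (n : (Fin Nt ⊕ Fin Nh) → ℝ) (hn : ∀ Ah, n (Sum.inr Ah) = 0)
    (k : (Fin Nt ⊕ Fin Nh) → ℝ) (hk : ∀ a, k a = ∑ A, Q⁻¹ a A * n A)
    (m : Fin 3 → ℝ) (r : (Fin Nt ⊕ Fin Nh) → Fin 3 → ℝ)
    (ρ : Fin Nt → ℝ) (hr : ∀ at', r (Sum.inl at') = ρ at' • m) :
    (∀ ah, k (Sum.inr ah) = 0) ∧
      (∀ At, (∑ a, Q⁻¹ a (Sum.inl At) • r a) = (∑ at', ρ at' * Qt⁻¹ at' At) • m) ∧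
      (∑ a, k a • r a) =
        (∑ at', ∑ At, ρ at' * Qt⁻¹ at' At * n (Sum.inl At)) • m := by
  have hinv : Q⁻¹ = Matrix.fromBlocks Qt⁻¹ 0 0 Qh⁻¹ := by
    apply Matrix.inv_eq_right_inv
    rw [hQ, Matrix.fromBlocks_multiply]
    simp [Matrix.mul_nonsing_inv _ hQt, Matrix.mul_nonsing_inv _ hQh]
  have hk2 : ∀ ah, k (Sum.inr ah) = 0 := by
    intro ah
    rw [hk, hinv]
    simp [Fintype.sum_sum_type, hn]
  have hk1 : ∀ b, k (Sum.inl b) = ∑ At, Qt⁻¹ b At * n (Sum.inl At) := by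
    intro b
    rw [hk, hinv]
    simp [Fintype.sum_sum_type]
  refine ⟨hk2, ?_, ?_⟩
  · intro At
    rw [hinv, Fintype.sum_sum_type, Finset.sum_smul]
    simp only [Matrix.fromBlocks_apply₁₁, Matrix.fromBlocks_apply₂₁, Matrix.zero_apply, zero_smul,
      Finset.sum_const_zero, add_zero, hr, smul_smul]
    exact Finset.sum_congr rfl fun b _ => by rw [mul_comm]
  · rw [Fintype.sum_sum_type, Finset.sum_smul]
    simp only [hk2, zero_smul, Finset.sum_const_zero, add_zero, hr, smul_smul, hk1]
    refine Finset.sum_congr rfl fun b _ => ?_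
    rw [mul_comm, Finset.mul_sum]
    simp only [mul_assoc]
end

section
/- Let Ñ, N̂ be positive natural numbers, let Q̃ be an invertible Ñ×Ñ real matrix, Q̂ an invertible N̂×N̂ real matrix, and Q = diag(Q̃, Q̂) the block-diagonal matrix. Let r¹ : Fin (Ñ+N̂) → ℝ, m₁ ∈ {−1, 1}, c : Fin Ñ → ℝ. Define for first-block flavors z_Ã = ∑_ã r_ã¹ (Q̃⁻¹)_{ãÃ}, and define fluxes k by k_ã = m₁ · ∑_{Ã,b̃} (Q̃⁻¹)_{ãÃ} · c_Ã² · r_b̃¹ · (Q̃⁻¹)_{b̃Ã} on the first block and k_â = 0 on the second block. If there exists a first-block flavor Ã with c_Ã ≠ 0 and z_Ã ≠ 0, then ∑_a r_a¹ k_a = m₁ ∑_Ã c_Ã² z_Ã² ≠ 0. -/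
open Matrix BigOperators

/-- Theorem 8 of the paper: type B2 solutions cannot have a vanishing
Bogomol'nyi bound: `∑_a r_a¹ k^a = m₁ ∑_Ã c_Ã² z_Ã² ≠ 0`. -/
theorem stmt_15 (Nt Nh : ℕ) (hNt : 0 < Nt) (hNh : 0 < Nh)
    (Qt : Matrix (Fin Nt) (Fin Nt) ℝ) (Qh : Matrix (Fin Nh) (Fin Nh) ℝ)
    (hQt : IsUnit Qt.det) (hQh : IsUnit Qh.det)
    (r1 : (Fin Nt ⊕ Fin Nh) → ℝ) (m₁ : ℝ) (hm : m₁ = 1 ∨ m₁ = -1)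
    (c : Fin Nt → ℝ) (z : Fin Nt → ℝ)
    (hz : ∀ At, z At = ∑ at', r1 (Sum.inl at') * Qt⁻¹ at' At)
    (k : (Fin Nt ⊕ Fin Nh) → ℝ)
    (hk1 : ∀ at', k (Sum.inl at') =
      m₁ * ∑ At, ∑ bt, Qt⁻¹ at' At * c At ^ 2 * r1 (Sum.inl bt) * Qt⁻¹ bt At)
    (hk2 : ∀ ah, k (Sum.inr ah) = 0)
    (hex : ∃ At, c At ≠ 0 ∧ z At ≠ 0) :
    (∑ a, r1 a * k a = m₁ * ∑ At, c At ^ 2 * z At ^ 2) ∧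
      (∑ a, r1 a * k a) ≠ 0 := by
  have hk : ∀ a, k (Sum.inl a) = m₁ * ∑ At, Qt⁻¹ a At * c At ^ 2 * z At := by
    intro a
    rw [hk1]
    congr 1
    refine Finset.sum_congr rfl fun At _ => ?_
    rw [hz, Finset.mul_sum]
    exact Finset.sum_congr rfl fun b _ => by ring
  have key : ∑ a, r1 a * k a = m₁ * ∑ At, c At ^ 2 * z At ^ 2 := by
    rw [Fintype.sum_sum_type]
    simp only [hk2, mul_zero, Finset.sum_const_zero, add_zero, hk]
    simp only [Finset.mul_sum]
    rw [Finset.sum_comm]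
    refine Finset.sum_congr rfl fun At _ => ?_
    have h : m₁ * (c At ^ 2 * z At ^ 2) = z At * (m₁ * c At ^ 2 * z At) := by ring
    rw [h]
    nth_rewrite 2 [hz At]
    rw [Finset.sum_mul]
    exact Finset.sum_congr rfl fun b _ => by ring
  refine ⟨key, ?_⟩
  rw [key]
  obtain ⟨A, hc, hzA⟩ := hex
  have hpos : 0 < ∑ At, c At ^ 2 * z At ^ 2 :=
    Finset.sum_pos' (fun i _ => by positivity) ⟨A, Finset.mem_univ _, by positivity⟩
  have hm0 : m₁ ≠ 0 := by rcases hm with h | h <;> rw [h] <;> norm_num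
  exact mul_ne_zero hm0 hpos.ne'
end
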